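/- arXiv:2403.07345 — 2 statements merged into one kernel-verified Lean document; each statement's English description precedes it below -/
import Mathlib

section
/- Let T be a bounded, self-adjoint, positive (positivity-preserving) linear operator on L²(m) for a σ-finite measure space (S, A, m). Then |min σ(T)| ≤ max σ(T) = ‖T‖. -/
open MeasureTheory
open scoped ComplexOrder

lemma inner_nn {S : Type*} [MeasurableSpace S] (m : Measure S) (a b : Lp ℂ 2 m)
    (ha : ∀ᵐ x ∂m, 0 ≤ a x) (hb : ∀ᵐ x ∂m, 0 ≤ b x) :
    0 ≤ (inner ℂ a b : ℂ) := by
  rw [L2.inner_def]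
  apply integral_nonneg_of_ae
  filter_upwards [ha, hb] with x h1 h2
  rw [RCLike.inner_apply]
  have : (starRingEnd ℂ) (a x) = a x := by
    rw [Complex.conj_eq_iff_im]; exact (Complex.nonneg_iff.1 h1).2.symm
  rw [this]
  exact mul_nonneg h2 h1

lemma decomp {S : Type*} [MeasurableSpace S] (m : Measure S) (f : Lp ℂ 2 m) :
    ∃ a b c d : Lp ℂ 2 m, (∀ᵐ x ∂m, 0 ≤ a x) ∧ (∀ᵐ x ∂m, 0 ≤ b x) ∧ (∀ᵐ x ∂m, 0 ≤ c x) ∧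
      (∀ᵐ x ∂m, 0 ≤ d x) ∧ f = (a - b) + Complex.I • (c - d) ∧
      (inner ℂ a b : ℂ) = 0 ∧ (inner ℂ c d : ℂ) = 0 := by
  have hf := Lp.memLp f
  have key : ∀ φ : ℂ → ℝ, Continuous φ → (∀ z, |φ z| ≤ ‖z‖) →
      ∃ a : Lp ℂ 2 m, ∀ᵐ x ∂m, a x = ((max (φ (f x)) 0 : ℝ) : ℂ) := by
    intro φ hφ hb
    have hm : MemLp (fun x => ((max (φ (f x)) 0 : ℝ) : ℂ)) 2 m := by
      refine hf.mono ?_ ?_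
      · exact (by fun_prop : Continuous (fun z : ℂ => ((max (φ z) 0 : ℝ) : ℂ))).comp_aestronglyMeasurable hf.1
      · refine Filter.Eventually.of_forall fun x => ?_
        rw [Complex.norm_real, Real.norm_eq_abs, abs_of_nonneg (le_max_right _ _)]
        exact max_le ((le_abs_self _).trans (hb _)) (norm_nonneg _)
    exact ⟨hm.toLp _, hm.coeFn_toLp⟩
  obtain ⟨a, ha⟩ := key Complex.re Complex.continuous_re Complex.abs_re_le_norm
  obtain ⟨b, hb⟩ := key (fun z => - z.re) (by fun_prop) (fun z => by rw [abs_neg]; exact Complex.abs_re_le_norm z)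
  obtain ⟨c, hc⟩ := key Complex.im Complex.continuous_im Complex.abs_im_le_norm
  obtain ⟨d, hd⟩ := key (fun z => - z.im) (by fun_prop) (fun z => by rw [abs_neg]; exact Complex.abs_im_le_norm z)
  have nn : ∀ r : ℝ, (0:ℂ) ≤ ((max r 0 : ℝ) : ℂ) := fun r => by
    exact_mod_cast le_max_right r 0
  have pm : ∀ r : ℝ, max r 0 - max (-r) 0 = r := fun r => by
    rcases le_total r 0 with h | h <;> simp [h]
  have pz : ∀ r : ℝ, max (-r) 0 * max r 0 = 0 := fun r => by
    rcases le_total r 0 with h | h <;> simp [h]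
  refine ⟨a, b, c, d, ?_, ?_, ?_, ?_, ?_, ?_, ?_⟩
  · filter_upwards [ha] with x h; rw [h]; exact nn _
  · filter_upwards [hb] with x h; rw [h]; exact nn _
  · filter_upwards [hc] with x h; rw [h]; exact nn _
  · filter_upwards [hd] with x h; rw [h]; exact nn _
  · apply Lp.ext
    filter_upwards [ha, hb, hc, hd, Lp.coeFn_add (a - b) (Complex.I • (c - d)), Lp.coeFn_sub a b,
      Lp.coeFn_sub c d, Lp.coeFn_smul Complex.I (c - d)] with x h1 h2 h3 h4 h5 h6 h7 h8
    rw [h5, Pi.add_apply, h6, h8, Pi.smul_apply, h7, Pi.sub_apply, Pi.sub_apply, h1, h2, h3, h4,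
      ← Complex.ofReal_sub, ← Complex.ofReal_sub, pm, pm, smul_eq_mul, mul_comm, Complex.re_add_im]
  · rw [L2.inner_def]
    refine integral_eq_zero_of_ae ?_
    filter_upwards [ha, hb] with x h1 h2
    rw [RCLike.inner_apply, h1, h2, Complex.conj_ofReal, ← Complex.ofReal_mul, pz]; simp
  · rw [L2.inner_def]
    refine integral_eq_zero_of_ae ?_
    filter_upwards [hc, hd] with x h1 h2
    rw [RCLike.inner_apply, h1, h2, Complex.conj_ofReal, ← Complex.ofReal_mul, pz]; simp

lemma expand {H : Type*} [NormedAddCommGroup H] [InnerProductSpace ℂ H]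
    (T : H →L[ℂ] H) (hs : ∀ x y, inner ℂ (T x) y = inner ℂ x (T y)) (a b c d : H)
    (hac : (inner ℂ (T a) c : ℂ).im = 0) (had : (inner ℂ (T a) d : ℂ).im = 0)
    (hbc : (inner ℂ (T b) c : ℂ).im = 0) (hbd : (inner ℂ (T b) d : ℂ).im = 0) :
    (inner ℂ (T ((a - b) + Complex.I • (c - d))) ((a - b) + Complex.I • (c - d)) : ℂ).re =
     ((inner ℂ (T a) a : ℂ).re + (inner ℂ (T b) b : ℂ).re - 2 * (inner ℂ (T a) b : ℂ).re) +
     ((inner ℂ (T c) c : ℂ).re + (inner ℂ (T d) d : ℂ).re - 2 * (inner ℂ (T c) d : ℂ).re) := by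
  have sw : ∀ x y, (inner ℂ (T x) y : ℂ) = (starRingEnd ℂ) (inner ℂ (T y) x) := fun x y => by
    rw [inner_conj_symm, hs]
  have h1 := sw b a
  have h2 := sw c a
  have h3 := sw d a
  have h4 := sw c b
  have h5 := sw d b
  have h6 := sw d c
  simp only [map_add, map_sub, map_smul, inner_add_left, inner_add_right, inner_sub_left,
    inner_sub_right, inner_smul_left, inner_smul_right, h1, h2, h3, h4, h5, h6]
  simp [hac, had, hbc, hbd, -inner_conj_symm]
  ring

lemma expand2 {H : Type*} [NormedAddCommGroup H] [InnerProductSpace ℂ H]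
    (T : H →L[ℂ] H) (hs : ∀ x y, inner ℂ (T x) y = inner ℂ x (T y)) (a b : H) :
    (inner ℂ (T (a + b)) (a + b) : ℂ).re =
     ((inner ℂ (T a) a : ℂ).re + (inner ℂ (T b) b : ℂ).re + 2 * (inner ℂ (T a) b : ℂ).re) := by
  have h1 : (inner ℂ (T b) a : ℂ) = (starRingEnd ℂ) (inner ℂ (T a) b) := by
    rw [inner_conj_symm, hs]
  simp only [map_add, inner_add_left, inner_add_right, h1]
  simp [-inner_conj_symm]
  ring

lemma lower {S : Type*} [MeasurableSpace S] (m : Measure S)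
    (T : Lp ℂ 2 m →L[ℂ] Lp ℂ 2 m) (hs : ∀ x y, inner ℂ (T x) y = inner ℂ x (T y))
    (hpos : ∀ g : Lp ℂ 2 m, (∀ᵐ x ∂m, 0 ≤ g x) → ∀ᵐ x ∂m, 0 ≤ T g x) (M : ℝ)
    (hM : ∀ f, (inner ℂ (T f) f : ℂ).re ≤ M * (inner ℂ f f : ℂ).re) (f : Lp ℂ 2 m) :
    -(M * (inner ℂ f f : ℂ).re) ≤ (inner ℂ (T f) f : ℂ).re := by
  obtain ⟨a, b, c, d, ha, hb, hc, hd, rfl, hab, hcd⟩ := decomp m f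
  have Q : ∀ x y : Lp ℂ 2 m, (∀ᵐ t ∂m, 0 ≤ x t) → (∀ᵐ t ∂m, 0 ≤ y t) →
      0 ≤ (inner ℂ (T x) y : ℂ).re ∧ (inner ℂ (T x) y : ℂ).im = 0 := fun x y hx hy => by
    have := Complex.nonneg_iff.1 (inner_nn m (T x) y (hpos x hx) hy)
    exact ⟨this.1, this.2.symm⟩
  have Q' : ∀ x y : Lp ℂ 2 m, (∀ᵐ t ∂m, 0 ≤ x t) → (∀ᵐ t ∂m, 0 ≤ y t) →
      (inner ℂ x y : ℂ).im = 0 := fun x y hx hy =>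
    (Complex.nonneg_iff.1 (inner_nn m x y hx hy)).2.symm
  have e1 := expand T hs a b c d (Q a c ha hc).2 (Q a d ha hd).2 (Q b c hb hc).2 (Q b d hb hd).2
  have e2 := expand (ContinuousLinearMap.id ℂ (Lp ℂ 2 m)) (fun _ _ => rfl) a b c d
    (Q' a c ha hc) (Q' a d ha hd) (Q' b c hb hc) (Q' b d hb hd)
  have e3 := expand2 T hs a b
  have e4 := expand2 T hs c d
  have e5 := expand2 (ContinuousLinearMap.id ℂ (Lp ℂ 2 m)) (fun _ _ => rfl) a b
  have e6 := expand2 (ContinuousLinearMap.id ℂ (Lp ℂ 2 m)) (fun _ _ => rfl) c d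
  simp only [ContinuousLinearMap.id_apply, hab, hcd, Complex.zero_re, mul_zero, sub_zero, add_zero] at e2 e5 e6
  have m1 := hM (a + b)
  have m2 := hM (c + d)
  rw [e3, e5] at m1
  rw [e4, e6] at m2
  rw [e1, e2]
  have := (Q a a ha ha).1
  have := (Q b b hb hb).1
  have := (Q c c hc hc).1
  have := (Q d d hd hd).1
  linarith

theorem abstract_case {H : Type*} [NormedAddCommGroup H] [InnerProductSpace ℂ H] [CompleteSpace H]
    (T : H →L[ℂ] H) (hsa : IsSelfAdjoint T)
    (hl : ∀ M : ℝ, (∀ f, (inner ℂ (T f) f : ℂ).re ≤ M * (inner ℂ f f : ℂ).re) →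
      ∀ f, -(M * (inner ℂ f f : ℂ).re) ≤ (inner ℂ (T f) f : ℂ).re) :
    |sInf {x : ℝ | (x : ℂ) ∈ spectrum ℂ T}| ≤ sSup {x : ℝ | (x : ℂ) ∈ spectrum ℂ T} ∧
    sSup {x : ℝ | (x : ℂ) ∈ spectrum ℂ T} = ‖T‖ := by
  have hR : {x : ℝ | (x : ℂ) ∈ spectrum ℂ T} = spectrum ℝ T :=
    spectrum.preimage_algebraMap (R := ℝ) ℂ
  rw [hR]
  rcases subsingleton_or_nontrivial (H →L[ℂ] H) with hs | hn
  · have : T = 0 := Subsingleton.elim _ _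
    simp [spectrum.of_subsingleton, this]
  have hbd : ∀ x ∈ spectrum ℝ T, |x| ≤ ‖T‖ := fun x hx => spectrum.norm_le_norm_of_mem hx
  have hba : BddAbove (spectrum ℝ T) := ⟨‖T‖, fun x hx => (le_abs_self x).trans (hbd x hx)⟩
  have hnorm := CStarAlgebra.norm_or_neg_norm_mem_spectrum hsa
  have hne : (spectrum ℝ T).Nonempty := hnorm.elim (fun h => ⟨_, h⟩) (fun h => ⟨_, h⟩)
  set M := sSup (spectrum ℝ T) with hMdef
  have hle : T ≤ algebraMap ℝ _ M :=
    le_algebraMap_of_spectrum_le (fun x hx => le_csSup hba hx) hsa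
  have hM : ∀ f, (inner ℂ (T f) f : ℂ).re ≤ M * (inner ℂ f f : ℂ).re := by
    intro f
    have h := (Complex.nonneg_iff.1
      (((ContinuousLinearMap.le_def _ _).1 hle).inner_nonneg_left f)).1
    rw [Algebra.algebraMap_eq_smul_one, sub_apply,
      smul_apply, one_apply_eq_self, inner_sub_left,
      ← Complex.coe_smul, inner_smul_left, Complex.conj_ofReal, Complex.sub_re,
      Complex.re_ofReal_mul] at h
    linarith
  have hlow := hl M hM
  have hge : algebraMap ℝ _ (-M) ≤ T := by
    rw [ContinuousLinearMap.le_def, ContinuousLinearMap.isPositive_def']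
    refine ⟨hsa.sub (IsSelfAdjoint.algebraMap _ (IsSelfAdjoint.all _)), fun f => ?_⟩
    have h := hlow f
    rw [ContinuousLinearMap.reApplyInnerSelf_apply]
    change 0 ≤ Complex.re _
    rw [Algebra.algebraMap_eq_smul_one, sub_apply,
      smul_apply, one_apply_eq_self, inner_sub_left,
      ← Complex.coe_smul, inner_smul_left, Complex.conj_ofReal, Complex.sub_re,
      Complex.re_ofReal_mul]
    linarith
  have hlo : ∀ x ∈ spectrum ℝ T, -M ≤ x := (algebraMap_le_iff_le_spectrum hsa).1 hge
  refine ⟨abs_le.2 ⟨le_csInf hne hlo, ?_⟩, le_antisymm ?_ ?_⟩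
  · obtain ⟨x, hx⟩ := hne
    exact (csInf_le ⟨-M, hlo⟩ hx).trans (le_csSup hba hx)
  · exact csSup_le hne fun x hx => (le_abs_self x).trans (hbd x hx)
  · rcases hnorm with h | h
    · exact le_csSup hba h
    · linarith [hlo _ h]

theorem stmt_3 {S : Type*} [MeasurableSpace S] (m : Measure S) [SigmaFinite m]
    (T : Lp ℂ 2 m →L[ℂ] Lp ℂ 2 m) (hsa : IsSelfAdjoint T)
    (hpos : ∀ g : Lp ℂ 2 m, (∀ᵐ x ∂m, 0 ≤ g x) → ∀ᵐ x ∂m, 0 ≤ T g x) :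
    |sInf {x : ℝ | (x : ℂ) ∈ spectrum ℂ T}| ≤ sSup {x : ℝ | (x : ℂ) ∈ spectrum ℂ T} ∧
    sSup {x : ℝ | (x : ℂ) ∈ spectrum ℂ T} = ‖T‖ := by
  have hsym : ∀ x y, inner ℂ (T x) y = inner ℂ x (T y) := fun x y =>
    (ContinuousLinearMap.isSelfAdjoint_iff_isSymmetric.1 hsa) x y
  exact abstract_case T hsa fun M hM => lower m T hsym hpos M hM
end

section
/- Let V: ℤᵈ → [0,∞) be bounded satisfying the sparseness condition a_ε(x) = Σ_{y≠x} √(V(x)V(y)) e^{-ε|x-y|} → 0 as |x| → ∞ for every ε > 0, and suppose v₀ := inf_n sup_{|x|≥n} V(x) > 0. Then for any L, ℓ > 0 and ε ∈ (0,1) there exists c ∈ ℤᵈ such that the cube Q(c,ℓ) = {x : |x-c|_∞ ≤ ℓ} is disjoint from Q(0,L), V(c) > (1-ε)v₀, and Σ_{x ∈ Q(c,ℓ)\{c}} V(x) < ε. -/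
/-- The ℓ¹ norm on `ℤᵈ`. -/
def znorm {d : ℕ} (x : Fin d → ℤ) : ℝ := ∑ i, |(x i : ℝ)|

/-- The sup norm on `ℤᵈ`. -/
noncomputable def zsupnorm {d : ℕ} (x : Fin d → ℤ) : ℝ := ⨆ i : Fin d, |(x i : ℝ)|

lemma summable_int_exp (a : ℝ) (ha : 0 < a) : Summable (fun k : ℤ => Real.exp (-a * |(k : ℝ)|)) := by
  have h1 : Summable (fun n : ℕ => Real.exp (-a * n)) := by
    have := Real.summable_exp_nat_mul_iff.2 (neg_lt_zero.2 ha)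
    refine this.congr (fun n => ?_)
    rw [mul_comm]
  refine Summable.of_nat_of_neg ?_ ?_
  · simpa using h1
  · simpa using h1

lemma summable_exp_znorm {d : ℕ} :
    Summable (fun y : Fin d → ℤ => Real.exp (-1 * znorm y)) := by
  have h1 := summable_int_exp 1 one_pos
  refine summable_of_sum_le (c := ∏ _i : Fin d, ∑' k : ℤ, Real.exp (-1 * |(k : ℝ)|))
    (fun y => (Real.exp_pos _).le) (fun u => ?_)
  classical
  have hsub : u ⊆ Fintype.piFinset (fun i : Fin d => u.image (fun y => (y i : ℤ))) := by
    intro y hy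
    rw [Fintype.mem_piFinset]
    intro i
    exact Finset.mem_image_of_mem _ hy
  calc ∑ y ∈ u, Real.exp (-1 * znorm y)
      ≤ ∑ y ∈ (Fintype.piFinset (fun i : Fin d => u.image (fun y => (y i : ℤ))) : Finset (Fin d → ℤ)),
          Real.exp (-1 * znorm y) :=
        Finset.sum_le_sum_of_subset_of_nonneg hsub (fun _ _ _ => (Real.exp_pos _).le)
    _ = ∑ y ∈ (Fintype.piFinset (fun i : Fin d => u.image (fun y => (y i : ℤ))) : Finset (Fin d → ℤ)),
          ∏ i, Real.exp (-1 * |(y i : ℝ)|) := by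
        refine Finset.sum_congr rfl (fun y _ => ?_)
        rw [znorm, Finset.mul_sum, Real.exp_sum]
    _ = ∏ i : Fin d, ∑ k ∈ (u.image (fun y => y i) : Finset ℤ), Real.exp (-1 * |(k : ℝ)|) :=
        by
        rw [Finset.prod_univ_sum (fun i : Fin d => u.image (fun y => (y i : ℤ)))
          (fun _ k => Real.exp (-1 * |(k : ℝ)|))]
    _ ≤ _ := by
        refine Finset.prod_le_prod (fun i _ => Finset.sum_nonneg fun _ _ => (Real.exp_pos _).le)
          (fun i _ => ?_)
        exact h1.sum_le_tsum _ (fun _ _ => (Real.exp_pos _).le)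

lemma abs_le_zsupnorm {d : ℕ} (x : Fin d → ℤ) (i : Fin d) : |(x i : ℝ)| ≤ zsupnorm x :=
  le_ciSup (f := fun i : Fin d => |(x i : ℝ)|) (Set.finite_range _).bddAbove i

lemma znorm_le_of {d : ℕ} (x : Fin d → ℤ) (a : ℝ) (h : ∀ i, |(x i : ℝ)| ≤ a) :
    znorm x ≤ d * a := by
  have := Finset.sum_le_card_nsmul Finset.univ (fun i : Fin d => |(x i : ℝ)|) a (fun i _ => h i)
  simpa [znorm] using this

theorem stmt_12 (d : ℕ) (hd : 0 < d) (V : (Fin d → ℤ) → ℝ)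
    (hV : ∀ x, 0 ≤ V x) (hVbd : ∃ M, ∀ x, V x ≤ M)
    (hsparse : ∀ ε > (0 : ℝ), ∀ δ > (0 : ℝ), ∃ R : ℝ, ∀ x : Fin d → ℤ, R ≤ znorm x →
      (∑' y : Fin d → ℤ,
        if y = x then 0 else Real.sqrt (V x * V y) * Real.exp (-ε * znorm (x - y))) < δ)
    (v0 : ℝ) (hv0 : v0 = ⨅ n : ℕ, ⨆ x : {x : Fin d → ℤ // (n : ℝ) ≤ znorm x}, V x)
    (hv0pos : 0 < v0) :
    ∀ L l : ℝ, 0 < L → 0 < l → ∀ ε ∈ Set.Ioo (0 : ℝ) 1, ∃ c : Fin d → ℤ,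
      (∀ x : Fin d → ℤ, zsupnorm (x - c) ≤ l → ¬ zsupnorm x ≤ L) ∧
      (1 - ε) * v0 < V c ∧
      (∑' x : {x : Fin d → ℤ // x ≠ c ∧ zsupnorm (x - c) ≤ l}, V x) < ε := by
  intro L l hL hl ε hε
  obtain ⟨hε0, hε1⟩ := hε
  obtain ⟨M, hM⟩ := hVbd
  have hb : 0 < (1 - ε) * v0 := mul_pos (by linarith) hv0pos
  set b := (1 - ε) * v0 with hbdef
  set K : ℝ := (Real.sqrt M / Real.sqrt b + 1) * Real.exp (d * l) with hK
  have hsb : 0 < Real.sqrt b := Real.sqrt_pos.2 hb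
  have hKpos : 0 < K := by positivity
  obtain ⟨R, hR⟩ := hsparse 1 one_pos (ε / K) (div_pos hε0 hKpos)
  obtain ⟨n, hn⟩ := exists_nat_gt (max R (d * (L + l)))
  have hnR := (le_max_left _ _).trans_lt hn
  have hnL := (le_max_right _ _).trans_lt hn
  have hle : v0 ≤ ⨆ x : {x : Fin d → ℤ // (n : ℝ) ≤ znorm x}, V x := by
    rw [hv0]
    refine ciInf_le ⟨0, ?_⟩ n
    rintro _ ⟨m, rfl⟩
    exact Real.iSup_nonneg (fun x => hV x)
  have hlt : b < ⨆ x : {x : Fin d → ℤ // (n : ℝ) ≤ znorm x}, V x := by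
    have : b < v0 := by rw [hbdef]; nlinarith
    linarith
  have hne : Nonempty {x : Fin d → ℤ // (n : ℝ) ≤ znorm x} := by
    by_contra h
    rw [not_nonempty_iff] at h
    rw [Real.iSup_of_isEmpty] at hlt
    linarith
  obtain ⟨⟨c, hc⟩, hVc⟩ := exists_lt_of_lt_ciSup hlt
  simp only at hVc
  refine ⟨c, ?_, hVc, ?_⟩
  · intro x hx1 hx2
    have := znorm_le_of c (L + l) (fun i => by
      have h1 := (abs_le_zsupnorm (x - c) i).trans hx1
      have h2 := (abs_le_zsupnorm x i).trans hx2
      simp only [Pi.sub_apply, Int.cast_sub] at h1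
      rw [abs_le] at h1 h2 ⊢
      constructor <;> linarith [h1.1, h1.2, h2.1, h2.2])
    linarith
  · have hM0 : 0 ≤ M := (hV c).trans (hM c)
    set f : (Fin d → ℤ) → ℝ := fun y =>
      if y = c then 0 else Real.sqrt (V c * V y) * Real.exp (-1 * znorm (c - y)) with hf
    have hf0 : ∀ y, 0 ≤ f y := by
      intro y
      simp only [hf]
      split_ifs
      · exact le_rfl
      · positivity
    have hE : Summable (fun y : Fin d → ℤ => Real.exp (-1 * znorm (c - y))) :=
      (Equiv.subLeft c).summable_iff.2 (summable_exp_znorm (d := d))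
    have hfs : Summable f := by
      refine Summable.of_nonneg_of_le hf0 (fun y => ?_) (hE.mul_left M)
      simp only [hf]
      split_ifs
      · positivity
      · refine mul_le_mul_of_nonneg_right ?_ (Real.exp_pos _).le
        rw [Real.sqrt_le_left hM0, sq]
        exact mul_le_mul (hM _) (hM _) (hV _) hM0
    have hsum : ∑' y, f y < ε / K := hR c (hnR.le.trans hc)
    have key : ∀ x : {x : Fin d → ℤ // x ≠ c ∧ zsupnorm (x - c) ≤ l}, V x ≤ K * f x := by
      rintro ⟨x, hxc, hxl⟩
      simp only [hf, if_neg hxc]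
      have hz : znorm (c - x) ≤ d * l := znorm_le_of _ _ (fun i => by
        have h1 := (abs_le_zsupnorm (x - c) i).trans hxl
        simp only [Pi.sub_apply, Int.cast_sub] at h1 ⊢
        rwa [abs_sub_comm])
      have he : 1 ≤ Real.exp (d * l) * Real.exp (-1 * znorm (c - x)) := by
        rw [← Real.exp_add]
        exact Real.one_le_exp (by linarith)
      have h1 : V x ≤ (Real.sqrt M / Real.sqrt b + 1) * Real.sqrt (V c * V x) := by
        have e1 : Real.sqrt b ≤ Real.sqrt (V c) := Real.sqrt_le_sqrt hVc.le
        have e2 : Real.sqrt (V x) ≤ Real.sqrt M := Real.sqrt_le_sqrt (hM x)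
        have e3 := Real.mul_self_sqrt (hV x)
        rw [Real.sqrt_mul (hV c)]
        calc V x = Real.sqrt (V x) * Real.sqrt (V x) := e3.symm
          _ ≤ Real.sqrt M * Real.sqrt (V x) := by gcongr
          _ = Real.sqrt M / Real.sqrt b * (Real.sqrt b * Real.sqrt (V x)) := by
              field_simp
          _ ≤ Real.sqrt M / Real.sqrt b * (Real.sqrt (V c) * Real.sqrt (V x)) := by gcongr
          _ ≤ (Real.sqrt M / Real.sqrt b + 1) * (Real.sqrt (V c) * Real.sqrt (V x)) := by
              gcongr
              linarith
      calc V x ≤ (Real.sqrt M / Real.sqrt b + 1) * Real.sqrt (V c * V x) := h1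
        _ ≤ (Real.sqrt M / Real.sqrt b + 1) * Real.sqrt (V c * V x) *
            (Real.exp (d * l) * Real.exp (-1 * znorm (c - x))) :=
            le_mul_of_one_le_right (by positivity) he
        _ = _ := by rw [hK]; ring
    have hKf : Summable (fun y => K * f y) := hfs.mul_left K
    have hKs : Summable (fun x : {x : Fin d → ℤ // x ≠ c ∧ zsupnorm (x - c) ≤ l} => K * f x) :=
      hKf.subtype {x : Fin d → ℤ | x ≠ c ∧ zsupnorm (x - c) ≤ l}
    have hVs := Summable.of_nonneg_of_le (fun x => hV _) key hKs
    calc _ ≤ ∑' x : {x : Fin d → ℤ // x ≠ c ∧ zsupnorm (x - c) ≤ l}, K * f x :=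
          hVs.tsum_le_tsum key hKs
      _ ≤ ∑' y, K * f y :=
          hKf.tsum_subtype_le (fun y => K * f y)
            {x : Fin d → ℤ | x ≠ c ∧ zsupnorm (x - c) ≤ l} (fun y => mul_nonneg hKpos.le (hf0 y))
      _ = K * ∑' y, f y := tsum_mul_left
      _ < K * (ε / K) := by gcongr
      _ = ε := by field_simp
end
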